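/- Tsirelson's bound / the quantum value of CHSH: for all positive integers n, m, every unit vector ψ ∈ ℂⁿ⊗ℂᵐ, and all families of complex matrices A_q^a ∈ M_n(ℂ) and B_q^a ∈ M_m(ℂ) (q, a ∈ {0,1}) such that each A_q^a and B_q^a is a Hermitian projection (self-adjoint and idempotent) and A_q^0 + A_q^1 = I_n, B_q^0 + B_q^1 = I_m for each q, one has (1/4) · Σ_{q1,q2∈{0,1}} Σ_{(a1,a2)∈{0,1}², a1 XOR a2 = q1 AND q2} ⟨ψ, (A_{q1}^{a1} ⊗ B_{q2}^{a2}) ψ⟩ ≤ cos²(π/8). -/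

import Mathlib

open Matrix
open scoped Kronecker

theorem kronecker_sub_aux {n m : ℕ} (X : Matrix (Fin n) (Fin n) ℂ)
    (Y Z : Matrix (Fin m) (Fin m) ℂ) : X ⊗ₖ (Y - Z) = X ⊗ₖ Y - X ⊗ₖ Z := by
  ext i j; simp [Matrix.kroneckerMap_apply, mul_sub]

theorem sub_kronecker_aux {n m : ℕ} (X Y : Matrix (Fin n) (Fin n) ℂ)
    (Z : Matrix (Fin m) (Fin m) ℂ) : (X - Y) ⊗ₖ Z = X ⊗ₖ Z - Y ⊗ₖ Z := by
  ext i j; simp [Matrix.kroneckerMap_apply, sub_mul]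

/-- Tsirelson's bound: every quantum strategy for the CHSH game, given by a shared
unit vector `ψ ∈ ℂⁿ ⊗ ℂᵐ` and binary projective measurements `A_q^a`, `B_q^a`,
wins with probability at most `cos²(π/8)`. -/
theorem tsirelson_bound (n m : ℕ) (hn : 0 < n) (hm : 0 < m)
    (ψ : Fin n × Fin m → ℂ) (hψ : ∑ i, ‖ψ i‖ ^ 2 = 1)
    (A : Bool → Bool → Matrix (Fin n) (Fin n) ℂ)
    (B : Bool → Bool → Matrix (Fin m) (Fin m) ℂ)
    (hAherm : ∀ q a, (A q a).IsHermitian)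
    (hAproj : ∀ q a, A q a * A q a = A q a)
    (hAsum : ∀ q, A q false + A q true = 1)
    (hBherm : ∀ q a, (B q a).IsHermitian)
    (hBproj : ∀ q a, B q a * B q a = B q a)
    (hBsum : ∀ q, B q false + B q true = 1) :
    ((1 / 4 : ℂ) *
        ∑ q : Bool × Bool,
          ∑ a ∈ Finset.univ.filter
              (fun a : Bool × Bool => xor a.1 a.2 = (q.1 && q.2)),
            ∑ i, (starRingEnd ℂ) (ψ i) *
              ((A q.1 a.1 ⊗ₖ B q.2 a.2).mulVec ψ) i).re ≤
      Real.cos (Real.pi / 8) ^ 2 := by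
  classical
  have hA1 : ∀ q, A q true = 1 - A q false := fun q => by rw [← hAsum q]; abel
  have hB1 : ∀ q, B q true = 1 - B q false := fun q => by rw [← hBsum q]; abel
  obtain ⟨P, hP⟩ : ∃ P : Bool → Matrix (Fin n × Fin m) (Fin n × Fin m) ℂ,
      ∀ q, P q = A q false ⊗ₖ (1 : Matrix (Fin m) (Fin m) ℂ) := ⟨_, fun _ => rfl⟩
  obtain ⟨Q, hQ⟩ : ∃ Q : Bool → Matrix (Fin n × Fin m) (Fin n × Fin m) ℂ,
      ∀ q, Q q = (1 : Matrix (Fin n) (Fin n) ℂ) ⊗ₖ B q false := ⟨_, fun _ => rfl⟩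
  have hPP : ∀ q, P q * P q = P q := fun q => by
    rw [hP, ← Matrix.mul_kronecker_mul, hAproj, one_mul]
  have hQQ : ∀ q, Q q * Q q = Q q := fun q => by
    rw [hQ, ← Matrix.mul_kronecker_mul, hBproj, one_mul]
  have hPQ : ∀ q r, P q * Q r = Q r * P q := fun q r => by
    rw [hP, hQ, ← Matrix.mul_kronecker_mul, ← Matrix.mul_kronecker_mul]; simp
  have hPs : ∀ q, star (P q) = P q := fun q => by
    rw [hP, Matrix.star_eq_conjTranspose, Matrix.conjTranspose_kronecker, (hAherm q false).eq,
      Matrix.conjTranspose_one]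
  have hQs : ∀ q, star (Q q) = Q q := fun q => by
    rw [hQ, Matrix.star_eq_conjTranspose, Matrix.conjTranspose_kronecker, (hBherm q false).eq,
      Matrix.conjTranspose_one]
  have k00 : ∀ q r, A q false ⊗ₖ B r false = P q * Q r := fun q r => by
    rw [hP, hQ, ← Matrix.mul_kronecker_mul]; simp
  have k01 : ∀ q r, A q false ⊗ₖ B r true = P q * (1 - Q r) := fun q r => by
    rw [hP, hQ, hB1, mul_sub, ← Matrix.mul_kronecker_mul, kronecker_sub_aux]; simp
  have k10 : ∀ q r, A q true ⊗ₖ B r false = (1 - P q) * Q r := fun q r => by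
    rw [hP, hQ, hA1, sub_mul, ← Matrix.mul_kronecker_mul, sub_kronecker_aux]; simp
  have k11 : ∀ q r, A q true ⊗ₖ B r true = (1 - P q) * (1 - Q r) := fun q r => by
    have h1 : (1 - P q) = A q true ⊗ₖ (1 : Matrix (Fin m) (Fin m) ℂ) := by
      rw [hP, hA1, sub_kronecker_aux]; simp
    have h2 : (1 - Q r) = (1 : Matrix (Fin n) (Fin n) ℂ) ⊗ₖ B r true := by
      rw [hQ, hB1, kronecker_sub_aux]; simp
    rw [h1, h2, ← Matrix.mul_kronecker_mul]; simp
  have hinv : ∀ p : Matrix (Fin n × Fin m) (Fin n × Fin m) ℂ, p * p = p →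
      (2 * p - 1) ^ 2 = 1 := fun p hp => by
    have : (2 * p - 1) ^ 2 = 4 * (p * p) - 4 * p + 1 := by noncomm_ring
    rw [this, hp]; simp
  have hsa : ∀ p : Matrix (Fin n × Fin m) (Fin n × Fin m) ℂ, star p = p →
      star (2 * p - 1) = 2 * p - 1 := fun p hp => by
    rw [two_mul, star_sub, star_add, hp, star_one]
  have hcm : ∀ p q : Matrix (Fin n × Fin m) (Fin n × Fin m) ℂ, p * q = q * p →
      (2 * p - 1) * (2 * q - 1) = (2 * q - 1) * (2 * p - 1) := fun p q h => by
    have h1 : (2 * p - 1) * (2 * q - 1) = 4 * (p * q) - 2 * p - 2 * q + 1 := by noncomm_ring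
    have h2 : (2 * q - 1) * (2 * p - 1) = 4 * (q * p) - 2 * p - 2 * q + 1 := by noncomm_ring
    rw [h1, h2, h]
  have T : IsCHSHTuple (2 * P false - 1) (2 * P true - 1) (2 * Q false - 1) (2 * Q true - 1) :=
    ⟨hinv _ (hPP _), hinv _ (hPP _), hinv _ (hQQ _), hinv _ (hQQ _),
      hsa _ (hPs _), hsa _ (hPs _), hsa _ (hQs _), hsa _ (hQs _),
      hcm _ _ (hPQ _ _), hcm _ _ (hPQ _ _), hcm _ _ (hPQ _ _), hcm _ _ (hPQ _ _)⟩
  obtain ⟨C, hC⟩ : ∃ C, C = (2 * P false - 1) * (2 * Q false - 1)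
      + (2 * P false - 1) * (2 * Q true - 1) + (2 * P true - 1) * (2 * Q false - 1)
      - (2 * P true - 1) * (2 * Q true - 1) := ⟨_, rfl⟩
  have key := by
    open scoped MatrixOrder in
    exact Matrix.le_iff.mp (tsirelson_inequality _ _ _ _ T)
  rw [← hC] at key
  obtain ⟨W, hW⟩ : ∃ W, W = ∑ q : Bool × Bool,
      ∑ a ∈ Finset.univ.filter (fun a : Bool × Bool => xor a.1 a.2 = (q.1 && q.2)),
        (A q.1 a.1 ⊗ₖ B q.2 a.2) := ⟨_, rfl⟩
  have hWC : W + W = C + 4 := by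
    rw [hW, hC, show (4 : Matrix (Fin n × Fin m) (Fin n × Fin m) ℂ) = 1 + 1 + 1 + 1 by norm_num]
    simp only [Finset.sum_filter, Fintype.sum_prod_type, Fintype.sum_bool]
    simp [k00, k01, k10, k11]
    noncomm_ring
  have hsum : (∑ q : Bool × Bool,
      ∑ a ∈ Finset.univ.filter (fun a : Bool × Bool => xor a.1 a.2 = (q.1 && q.2)),
        ∑ i, (starRingEnd ℂ) (ψ i) * ((A q.1 a.1 ⊗ₖ B q.2 a.2).mulVec ψ) i)
      = star ψ ⬝ᵥ (W *ᵥ ψ) := by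
    rw [hW]
    simp only [Matrix.sum_mulVec, dotProduct_sum]
    rfl
  rw [hsum]
  have hn1 : star ψ ⬝ᵥ ψ = 1 := by
    have : star ψ ⬝ᵥ ψ = ((∑ i, ‖ψ i‖ ^ 2 : ℝ) : ℂ) := by
      push_cast
      exact Finset.sum_congr rfl fun i _ => Complex.conj_mul' (ψ i)
    rw [this, hψ]; simp
  have h2 : (star ψ ⬝ᵥ (W *ᵥ ψ)) + (star ψ ⬝ᵥ (W *ᵥ ψ)) = (star ψ ⬝ᵥ (C *ᵥ ψ)) + 4 := by
    rw [← dotProduct_add, ← Matrix.add_mulVec, hWC, Matrix.add_mulVec, dotProduct_add]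
    have h4 : (4 : Matrix (Fin n × Fin m) (Fin n × Fin m) ℂ) = (4 : ℂ) • 1 := by
      ext i j; simp [Matrix.ofNat_apply, Matrix.one_apply]
    rw [h4, Matrix.smul_mulVec, Matrix.one_mulVec, dotProduct_smul, hn1]; simp
  have h3 := key.re_dotProduct_nonneg ψ
  rw [Matrix.sub_mulVec, dotProduct_sub, Matrix.smul_mulVec, Matrix.one_mulVec,
    dotProduct_smul, hn1] at h3
  have h2r := congrArg Complex.re h2
  simp at h2r h3
  have hs : √2 ^ 3 = 2 * √2 := by
    rw [pow_succ, Real.sq_sqrt (by norm_num)]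
  have hs' : ((√2 : ℂ) ^ 3).re = √2 ^ 3 := by
    rw [← Complex.ofReal_pow, Complex.ofReal_re]
  have h5 : ((1 / 4 : ℂ) * (star ψ ⬝ᵥ (W *ᵥ ψ))).re = 1 / 4 * (star ψ ⬝ᵥ (W *ᵥ ψ)).re := by
    simp
  rw [h5, Real.cos_sq, show 2 * (Real.pi / 8) = Real.pi / 4 by ring, Real.cos_pi_div_four]
  linarith
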